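/- Consider 3-dimensional cubes of symmetric (21,5,1) designs, i.e. functions C : Fin 21 → Fin 21 → Fin 21 → {0,1} all of whose slices M satisfy M·Mᵀ = 4·I + J. Among these, the group cubes — cubes paratopic to one of the form (i₁,i₂,i₃) ↦ [g(i₂)·g(i₃) ∈ B(i₁)] for some group G of order 21, bijection g : Fin 21 → G, and family B : Fin 21 → Finset G in which every B(i) is a (21,5,1) difference set in G and every pair of distinct elements of G lies in exactly one set B(i) — fall into exactly three paratopy classes, and exactly two of these classes contain a difference cube, i.e. a cube of the form (i₁,i₂,i₃) ↦ [g(i₁)·g(i₂)·g(i₃) ∈ D] for a (21,5,1) difference set D ⊆ G. -/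

import Mathlib

/-- `C` is an `n`-dimensional cube of symmetric `(v,k,λ)` designs: a `{0,1}`-valued function on
`(Fin n → Fin v)` all of whose 2-dimensional slices `M` satisfy `M·Mᵀ = (k−λ)·I + λ·J`. -/
def IsCubeOfDesigns (v k l n : ℕ) (C : (Fin n → Fin v) → ℤ) : Prop :=
  (∀ i, C i = 0 ∨ C i = 1) ∧
  ∀ x y : Fin n, x ≠ y → ∀ fixed : Fin n → Fin v,
    (Matrix.of fun a b : Fin v =>
        C (fun t => if t = x then a else if t = y then b else fixed t)) *
      (Matrix.of fun a b : Fin v =>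
        C (fun t => if t = x then a else if t = y then b else fixed t)).transpose =
      ((k : ℤ) - (l : ℤ)) • 1 + (l : ℤ) • Matrix.of (fun _ _ => 1)

/-- Two `n`-cubes of order `v` are paratopic if one is mapped onto the other by permuting each
of the `n` index sets independently combined with permuting the coordinate positions. -/
def Paratopic (v n : ℕ) (C₁ C₂ : (Fin n → Fin v) → ℤ) : Prop :=
  ∃ (γ : Equiv.Perm (Fin n)) (α : Fin n → Equiv.Perm (Fin v)),
    ∀ i, C₂ i = C₁ (fun t => α t (i (γ t)))

/-- `C` is paratopic to a difference cube over `G`, i.e. to a `3`-cube of the form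
`(i₁,i₂,i₃) ↦ [g(i₁)·g(i₂)·g(i₃) ∈ D]` for a `(v,k,λ)` difference set `D ⊆ G`. -/
def IsDifferenceCubeOver (v k l : ℕ) (G : Type) [Group G] [Fintype G] [DecidableEq G]
    (C : (Fin 3 → Fin v) → ℤ) : Prop :=
  Fintype.card G = v ∧
  ∃ (g : Fin v ≃ G) (D : Finset G),
    D.card = k ∧
    (∀ h : G, h ≠ 1 → ((D ×ˢ D).filter (fun p => p.1⁻¹ * p.2 = h)).card = l) ∧
    Paratopic v 3 C (fun i => if g (i 0) * g (i 1) * g (i 2) ∈ D then 1 else 0)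

/-- `C` is a difference cube for some group of order `v`. -/
def IsDifferenceCube (v k l : ℕ) (C : (Fin 3 → Fin v) → ℤ) : Prop :=
  ∃ (G : Type) (iG : Group G) (iF : Fintype G) (iD : DecidableEq G),
    @IsDifferenceCubeOver v k l G iG iF iD C

/-- `C` is paratopic to a group cube over `G`: a `3`-cube `(i₁,i₂,i₃) ↦ [g(i₂)·g(i₃) ∈ B(i₁)]`
where every block `B(i)` is a `(v,k,λ)` difference set in `G` and the blocks form a symmetric
`(v,k,λ)` design over `G`. -/
def IsGroupCubeOver (v k l : ℕ) (G : Type) [Group G] [Fintype G] [DecidableEq G]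
    (C : (Fin 3 → Fin v) → ℤ) : Prop :=
  Fintype.card G = v ∧
  ∃ (g : Fin v ≃ G) (B : Fin v → Finset G),
    (∀ i, (B i).card = k) ∧
    (∀ i, ∀ h : G, h ≠ 1 →
      (((B i) ×ˢ (B i)).filter (fun p => p.1⁻¹ * p.2 = h)).card = l) ∧
    (∀ x y : G, x ≠ y →
      (Finset.univ.filter (fun i : Fin v => x ∈ B i ∧ y ∈ B i)).card = l) ∧
    Paratopic v 3 C (fun i => if g (i 1) * g (i 2) ∈ B (i 0) then 1 else 0)

/-- `C` is a group cube for some group of order `v`. -/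
def IsGroupCube (v k l : ℕ) (C : (Fin 3 → Fin v) → ℤ) : Prop :=
  ∃ (G : Type) (iG : Group G) (iF : Fintype G) (iD : DecidableEq G),
    @IsGroupCubeOver v k l G iG iF iD C

namespace GroupCubes

/-- A generator `b` of order `3` acts on a generator `a` of order `7` by raising it to this
power. -/
def twist (s : Bool) : ℕ := bif s then 2 else 1

/-- The product on `{0, …, 20}`, where `i + 7 * j` stands for `a ^ i * b ^ j`. -/
def mulN (s : Bool) (x y : ℕ) : ℕ :=
  (x % 7 + twist s ^ (x / 7) * (y % 7)) % 7 + 7 * ((x / 7 + y / 7) % 3)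

def invN (s : Bool) (x : ℕ) : ℕ :=
  ((7 - x % 7) * twist s ^ (2 * (x / 7))) % 7 + 7 * ((3 - x / 7) % 3)

theorem mulN_lt (s : Bool) (x y : ℕ) : mulN s x y < 21 := by
  unfold mulN
  omega

theorem invN_lt (s : Bool) (x : ℕ) : invN s x < 21 := by
  unfold invN
  omega

/-- The cyclic group of order `21` and the non-abelian one. -/
def Order21 (_ : Bool) : Type := Fin 21

namespace Order21

variable {s : Bool}

instance : Fintype (Order21 s) := inferInstanceAs (Fintype (Fin 21))

instance : DecidableEq (Order21 s) := inferInstanceAs (DecidableEq (Fin 21))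

/-- The index of an element. -/
def val (x : Order21 s) : ℕ := Fin.val (n := 21) x

def mk (x : ℕ) (h : x < 21) : Order21 s := (⟨x, h⟩ : Fin 21)

@[ext] theorem ext {x y : Order21 s} (h : x.val = y.val) : x = y := Fin.ext h

theorem val_lt (x : Order21 s) : x.val < 21 := Fin.isLt (n := 21) x

instance : Mul (Order21 s) := ⟨fun x y => mk (mulN s x.val y.val) (mulN_lt s _ _)⟩

instance : Inv (Order21 s) := ⟨fun x => mk (invN s x.val) (invN_lt s _)⟩

instance : One (Order21 s) := ⟨mk 0 (by norm_num)⟩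

@[simp] theorem val_mk (x : ℕ) (h : x < 21) : (mk x h : Order21 s).val = x := rfl

theorem val_mul (x y : Order21 s) : (x * y).val = mulN s x.val y.val := rfl

instance : Group (Order21 s) :=
  Group.ofLeftAxioms
    (by cases s <;> decide +kernel) (by cases s <;> decide +kernel) (by cases s <;> decide +kernel)

end Order21

section Classification

variable {G : Type} [Group G]

theorem conj_pow_pow {a b : G} {r : ℕ} (h : b * a = a ^ r * b) (i j : ℕ) :
    b ^ j * a ^ i = a ^ (r ^ j * i) * b ^ j := by
  have h1 : ∀ i, b * a ^ i = a ^ (r * i) * b := fun i => by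
    have : SemiconjBy b a (a ^ r) := h
    simpa [← pow_mul, SemiconjBy] using this.pow_right i
  induction j generalizing i with
  | zero => simp
  | succ j ih =>
    rw [pow_succ, pow_succ, mul_assoc, h1, ← mul_assoc, ih, mul_assoc, mul_assoc]

theorem nonempty_mulEquiv_of_conj [Fintype G] (hG : Fintype.card G = 21) {a b : G}
    (ha : orderOf a = 7) (hb : orderOf b = 3) {s : Bool} (h : b * a = a ^ twist s * b) :
    Nonempty (Order21 s ≃* G) := by
  let f : Order21 s → G := fun x => a ^ (x.val % 7) * b ^ (x.val / 7)
  have hf : ∀ x y, f (x * y) = f x * f y := by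
    intro x y
    have h1 : f (x * y) = a ^ (x.val % 7 + twist s ^ (x.val / 7) * (y.val % 7)) *
        b ^ (x.val / 7 + y.val / 7) := by
      simp only [f, Order21.val_mul]
      rw [← pow_mod_orderOf a (_ + _), ← pow_mod_orderOf b (_ + _), ha, hb]
      congr 2 <;> unfold mulN <;> omega
    rw [h1, pow_add, pow_add, mul_assoc, ← mul_assoc (a ^ _) (b ^ _), ← conj_pow_pow h]
    simp only [f, mul_assoc]
  have hinj : Function.Injective f := by
    refine (injective_iff_map_eq_one (MonoidHom.mk' f hf)).2 fun x hx => ?_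
    replace hx : a ^ (x.val % 7) * b ^ (x.val / 7) = 1 := hx
    have hab : a ^ (x.val % 7) = (b ^ (x.val / 7))⁻¹ := eq_inv_of_mul_eq_one_left hx
    have hcop : a ^ (x.val % 7) = 1 := by
      rw [← orderOf_eq_one_iff]
      refine Nat.eq_one_of_dvd_coprimes (show Nat.Coprime 7 3 by norm_num) ?_ ?_
      · exact ha ▸ orderOf_pow_dvd _
      · rw [hab, orderOf_inv]
        exact hb ▸ orderOf_pow_dvd _
    have hb1 : b ^ (x.val / 7) = 1 := by simpa [hcop] using hx
    have h7 := ha ▸ orderOf_dvd_of_pow_eq_one hcop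
    have h3 := hb ▸ orderOf_dvd_of_pow_eq_one hb1
    have := x.val_lt
    ext
    show x.val = 0
    omega
  have hbij : Function.Bijective f :=
    (Fintype.bijective_iff_injective_and_card f).2 ⟨hinj, by rw [hG]; rfl⟩
  exact ⟨MulEquiv.ofBijective (MonoidHom.mk' f hf) hbij⟩

theorem exists_mulEquiv_order21 [Fintype G] (hG : Fintype.card G = 21) :
    ∃ s, Nonempty (Order21 s ≃* G) := by
  classical
  have : Fact (Nat.Prime 7) := ⟨by norm_num⟩
  have : Fact (Nat.Prime 3) := ⟨by norm_num⟩
  obtain ⟨a, ha⟩ := exists_prime_orderOf_dvd_card (G := G) 7 (by rw [hG]; norm_num)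
  obtain ⟨b, hb⟩ := exists_prime_orderOf_dvd_card (G := G) 3 (by rw [hG]; norm_num)
  have hN : (Subgroup.zpowers a).Normal := by
    refine Subgroup.normal_of_index_eq_minFac_card ?_
    have h := (Subgroup.zpowers a).card_mul_index
    rw [Nat.card_zpowers, ha, Nat.card_eq_fintype_card, hG] at h
    rw [Nat.card_eq_fintype_card, hG, show Nat.minFac 21 = 3 by norm_num]
    omega
  have hmem : b * a * b⁻¹ ∈ Subgroup.zpowers a :=
    hN.conj_mem a (Subgroup.mem_zpowers a) b
  rw [← mem_powers_iff_mem_zpowers, mem_powers_iff_mem_range_orderOf, ha] at hmem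
  obtain ⟨r, hr, hrab⟩ := Finset.mem_image.1 hmem
  rw [Finset.mem_range] at hr
  have hconj : b * a = a ^ r * b := by simp [hrab]
  have hr3 : r ^ 3 * 1 ≡ 1 [MOD 7] := by
    have h := conj_pow_pow hconj 1 3
    rw [← hb, pow_orderOf_eq_one] at h
    rw [← ha, ← pow_eq_pow_iff_modEq]
    simpa [hb] using h.symm
  have hcases : r = 1 ∨ r = 2 ∨ r = 4 := by
    interval_cases r <;> revert hr3 <;> decide
  rcases hcases with rfl | rfl | rfl
  · exact ⟨false, nonempty_mulEquiv_of_conj hG ha hb hconj⟩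
  · exact ⟨true, nonempty_mulEquiv_of_conj hG ha hb hconj⟩
  · refine ⟨true, nonempty_mulEquiv_of_conj hG ha (b := b ^ 2) ?_ ?_⟩
    · rw [orderOf_pow, hb]
      rfl
    · have h := conj_pow_pow hconj 1 2
      rw [← pow_mod_orderOf a (_ * _), ha] at h
      simpa [twist] using h

end Classification
section Enumeration

/-- `k n`, with `n` evaluated first. -/
def force {α : Sort*} (n : ℕ) (k : ℕ → α) : α :=
  Nat.rec (k 0) (fun m _ => k (Nat.succ m)) n

theorem force_eq {α : Sort*} (n : ℕ) (k : ℕ → α) : force n k = k n := by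
  cases n <;> rfl

/-- `k l`, with the entries of `l` evaluated first. -/
def forceList {α : Sort*} : List ℕ → (List ℕ → α) → α
  | [], k => k []
  | x :: xs, k => force x fun y => forceList xs fun ys => k (y :: ys)

theorem forceList_eq {α : Sort*} (l : List ℕ) (k : List ℕ → α) : forceList l k = k l := by
  induction l generalizing k with
  | nil => rfl
  | cons x xs ih => rw [forceList, force_eq, ih]

/-- `k L`, with the entries of the members of `L` evaluated first. -/
def forceLists {α : Sort*} : List (List ℕ) → (List (List ℕ) → α) → α
  | [], k => k []
  | x :: xs, k => forceList x fun y => forceLists xs fun ys => k (y :: ys)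

theorem forceLists_eq {α : Sort*} (L : List (List ℕ)) (k : List (List ℕ) → α) :
    forceLists L k = k L := by
  induction L generalizing k with
  | nil => rfl
  | cons x xs ih => rw [forceLists, forceList_eq, ih]

/-- `k (l.filter f)`, with the filtered list evaluated first. -/
def filterThen {α : Sort*} (f : ℕ → Bool) (l : List ℕ) : (List ℕ → α) → α :=
  List.rec (fun k => k [])
    (fun x _ ih k => ih fun ys => Bool.rec (k ys) (k (x :: ys)) (f x)) l

theorem filterThen_eq {α : Sort*} (f : ℕ → Bool) (l : List ℕ) (k : List ℕ → α) :
    filterThen f l k = k (l.filter f) := by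
  induction l generalizing k with
  | nil => rfl
  | cons x xs ih =>
    refine (ih _).trans ?_
    cases h : f x <;> simp [h]

/-- The number whose binary digits equal to `1` are at the places listed in `l`. -/
def listMask (l : List ℕ) : ℕ := l.foldr (fun c a => 2 ^ c ||| a) 0

@[simp] theorem testBit_listMask (l : List ℕ) (x : ℕ) :
    (listMask l).testBit x = true ↔ x ∈ l := by
  induction l with
  | nil => simp [listMask]
  | cons c l ih =>
    have : listMask (c :: l) = 2 ^ c ||| listMask l := rfl
    rw [this, Nat.testBit_or, Bool.or_eq_true, ih, Nat.testBit_two_pow, decide_eq_true_iff,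
      List.mem_cons, eq_comm]

def quot (s : Bool) (x y : ℕ) : ℕ := mulN s (invN s x) y

def quotFrom (s : Bool) (n : ℕ) (l : List ℕ) : ℕ := listMask (l.map fun c => quot s n c)

def quotTo (s : Bool) (n : ℕ) (l : List ℕ) : ℕ := listMask (l.map fun c => quot s c n)

/-- The masks of the sets arising from `l` by adding `k` numbers below `n` in such a way that all
quotients remain distinct, followed by `res`; `used` is the set of the quotients within `l`. -/
def sidon (s : Bool) : ℕ → ℕ → List ℕ → ℕ → List ℕ → List ℕ
  | _, 0, l, _, res => listMask l :: res
  | 0, _ + 1, _, _, res => res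
  | n + 1, k + 1, l, used, res =>
    force (quotFrom s n l) fun a => force (quotTo s n l) fun b =>
      bif (a &&& b).beq 0 && ((a ||| b) &&& used).beq 0 then
        sidon s n k (n :: l) (a ||| b ||| used) (sidon s n (k + 1) l used res)
      else sidon s n (k + 1) l used res

theorem mem_cond {b : Bool} {l l' : List ℕ} {m : ℕ} (h : m ∈ l) (h' : m ∈ l') :
    m ∈ bif b then l else l' := by
  cases b
  · exact h'
  · exact h

theorem mem_sidon_of_mem (s : Bool) (n : ℕ) : ∀ (k : ℕ) (l : List ℕ) (used : ℕ) (res : List ℕ)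
    {m : ℕ}, m ∈ res → m ∈ sidon s n k l used res := by
  induction n with
  | zero =>
    intro k l used res m hm
    cases k <;> simp [sidon, hm]
  | succ n ih =>
    intro k l used res m hm
    cases k with
    | zero => simp [sidon, hm]
    | succ k =>
      simp only [sidon, force_eq]
      exact mem_cond (ih _ _ _ _ (ih _ _ _ _ hm)) (ih _ _ _ _ hm)

theorem and_beq_zero {a b : ℕ} (h : ∀ x, a.testBit x = true → b.testBit x = true → False) :
    (a &&& b).beq 0 = true := by
  rw [Nat.beq_eq]
  refine Nat.eq_of_testBit_eq fun x => ?_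
  have := h x
  cases h1 : a.testBit x <;> cases h2 : b.testBit x <;> simp_all

theorem mem_sidon {s : Bool} {p : ℕ → Bool}
    (hp : ∀ x y z w, p x → p y → p z → p w → x ≠ y → quot s x y = quot s z w → x = z ∧ y = w)
    (n : ℕ) : ∀ (k : ℕ) (l : List ℕ) (used : ℕ) (res : List ℕ),
    (∀ c ∈ l, p c ∧ n ≤ c) →
    (∀ h, used.testBit h = true → ∃ c ∈ l, ∃ d ∈ l, c ≠ d ∧ quot s c d = h) →
    ((List.range n).filter p).length = k →
    listMask ((List.range n).filter p ++ l) ∈ sidon s n k l used res := by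
  induction n with
  | zero =>
    rintro _ l used res - - rfl
    simp [sidon]
  | succ n ih =>
    intro k l used res hl hused hk
    rw [List.range_succ, List.filter_append] at hk ⊢
    cases k with
    | zero =>
      rw [List.length_eq_zero_iff] at hk
      simp [sidon, hk]
    | succ k =>
      simp only [sidon, force_eq]
      have hl' : ∀ c ∈ l, p c ∧ n ≤ c := fun c hc =>
        ⟨(hl c hc).1, (Nat.le_succ n).trans (hl c hc).2⟩
      by_cases hn : p n
      · have hne : ∀ c ∈ l, n ≠ c := fun c hc => Nat.ne_of_lt (hl c hc).2
        have ha : ∀ h, (quotFrom s n l).testBit h = true ↔ ∃ c ∈ l, quot s n c = h := by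
          simp [quotFrom]
        have hb : ∀ h, (quotTo s n l).testBit h = true ↔ ∃ c ∈ l, quot s c n = h := by
          simp [quotTo]
        have h1 : (quotFrom s n l &&& quotTo s n l).beq 0 = true := by
          refine and_beq_zero fun h h1 h2 => ?_
          obtain ⟨c, hc, rfl⟩ := (ha h).1 h1
          obtain ⟨d, hd, h3⟩ := (hb _).1 h2
          exact hne d hd (hp n c d n hn (hl c hc).1 (hl d hd).1 hn (hne c hc) h3.symm).1
        have h2 : ((quotFrom s n l ||| quotTo s n l) &&& used).beq 0 = true := by
          refine and_beq_zero fun h h1 h2 => ?_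
          obtain ⟨d, hd, f, hf, hdf, h3⟩ := hused h h2
          rw [Nat.testBit_or, Bool.or_eq_true, ha, hb] at h1
          rcases h1 with ⟨c, hc, rfl⟩ | ⟨c, hc, rfl⟩
          · exact hne d hd (hp n c d f hn (hl c hc).1 (hl d hd).1 (hl f hf).1 (hne c hc) h3.symm).1
          · exact hne f hf
              (hp c n d f (hl c hc).1 hn (hl d hd).1 (hl f hf).1 (hne c hc).symm h3.symm).2
        rw [h1, h2]
        have := ih k (n :: l) (quotFrom s n l ||| quotTo s n l ||| used)
          (sidon s n (k + 1) l used res) ?_ ?_ ?_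
        · simpa [hn] using this
        · intro c hc
          rcases List.mem_cons.1 hc with rfl | hc
          · exact ⟨hn, le_rfl⟩
          · exact hl' c hc
        · intro h hh
          rw [Nat.testBit_or, Nat.testBit_or, Bool.or_eq_true, Bool.or_eq_true, ha, hb] at hh
          rcases hh with (⟨c, hc, h3⟩ | ⟨c, hc, h3⟩) | h3
          · exact ⟨n, by simp, c, by simp [hc], hne c hc, h3⟩
          · exact ⟨c, by simp [hc], n, by simp, (hne c hc).symm, h3⟩
          · obtain ⟨c, hc, d, hd, h4⟩ := hused h h3
            exact ⟨c, by simp [hc], d, by simp [hd], h4⟩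
        · simpa [hn] using hk
      · have hk' : ((List.range n).filter p).length = k + 1 := by simpa [hn] using hk
        have h1 := fun res => ih (k + 1) l used res hl' hused hk'
        rw [List.filter_cons_of_neg hn, List.filter_nil, List.append_nil]
        exact mem_cond (mem_sidon_of_mem _ _ _ _ _ _ (h1 res)) (h1 res)

/-- Two masks are equal or have at most one place in common. -/
def compatible (x y : ℕ) : Bool :=
  Bool.rec (x.beq y) true (((x.land y).land ((x.land y).sub 1)).beq 0)

theorem and_sub_one_eq_zero {z : ℕ}
    (h : ∀ x y, z.testBit x = true → z.testBit y = true → x = y) : z &&& (z - 1) = 0 := by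
  rcases eq_or_ne z 0 with rfl | hz
  · rfl
  · obtain ⟨k, hk⟩ := Nat.exists_testBit_of_ne_zero hz
    have : z = 2 ^ k := Nat.eq_of_testBit_eq fun x => by
      rw [Nat.testBit_two_pow, Bool.eq_iff_iff, decide_eq_true_iff]
      exact ⟨fun hx => h _ _ hk hx, fun hx => hx ▸ hk⟩
    rw [this, Nat.and_two_pow_sub_one_eq_mod, Nat.mod_self]

theorem compatible_of_forall {x y : ℕ} (h : x ≠ y → ∀ i j, x.testBit i = true →
    y.testBit i = true → x.testBit j = true → y.testBit j = true → i = j) :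
    compatible x y = true := by
  by_cases hxy : x = y
  · have : x.beq y = true := by rw [Nat.beq_eq, hxy]
    unfold compatible
    rw [this]
    generalize ((x.land y).land ((x.land y).sub 1)).beq 0 = b
    cases b <;> rfl
  · have : ((x.land y).land ((x.land y).sub 1)).beq 0 = true := by
      rw [Nat.beq_eq]
      refine and_sub_one_eq_zero (z := x &&& y) fun i j hi hj => ?_
      rw [Nat.testBit_and, Bool.and_eq_true] at hi hj
      exact h hxy i j hi.1 hi.2 hj.1 hj.2
    unfold compatible
    rw [this]

/-- Check `leaf` on all sublists of `l` obtained by choosing for each mask in the first list a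
mask in `l` that contains it, and discarding the masks incompatible with the chosen ones. -/
def search (leaf : List ℕ → Bool) : List ℕ → List ℕ → Bool
  | [], l => leaf l
  | p :: ps, l => filterThen (fun m => (m.land p).beq p) l fun l' => l'.all fun m =>
      filterThen (compatible m) l (search leaf ps)

theorem exists_leaf_of_search {leaf : List ℕ → Bool} {F : ℕ → Prop}
    (hF : ∀ x y, F x → F y → compatible x y = true) : ∀ (ps l : List ℕ),
    (∀ p ∈ ps, ∃ x, F x ∧ x &&& p = p) → (∀ x, F x → x ∈ l) → search leaf ps l = true →
    ∃ l', leaf l' = true ∧ ∀ x, F x → x ∈ l'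
  | [], l, _, hl, h => ⟨l, h, hl⟩
  | p :: ps, l, hps, hl, h => by
    obtain ⟨m, hm, hmp⟩ := hps p (by simp)
    rw [search, filterThen_eq, List.all_eq_true] at h
    have h1 := h m (List.mem_filter.2 ⟨hl m hm, by rw [Nat.beq_eq]; exact hmp⟩)
    rw [filterThen_eq] at h1
    exact exists_leaf_of_search hF ps _ (fun q hq => hps q (by simp [hq]))
      (fun x hx => List.mem_filter.2 ⟨hl x hx, hF m x hm hx⟩) h1

end Enumeration
section Families

/-- Three difference sets: `{a, a², a⁴, b, b²}` in both groups, and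
`{1, a³b, a⁵b, a⁶b, b²}` and `{1, b, a³b², a⁵b², a⁶b²}` in the non-abelian group. -/
def baseBlock : ℕ → ℕ
  | 0 => 16534
  | 1 => 29697
  | _ => 1704065

/-- The left translates of the first base block. -/
def leftFamily (s : Bool) (i x : ℕ) : Bool := (baseBlock 0).testBit (mulN s i x)

/-- The right translates of the first base block. -/
def rightFamily (s : Bool) (i x : ℕ) : Bool := (baseBlock 0).testBit (mulN s x i)

/-- The sets `aⁱBaⁱ` for the three base blocks `B`. -/
def mixedFamily (i x : ℕ) : Bool :=
  (baseBlock (i / 7)).testBit (mulN true (mulN true (i % 7) x) (i % 7))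

/-- The automorphism inverting `a` and fixing `b`, if `t` is true. -/
def reflN (t : Bool) (x : ℕ) : ℕ := bif t then 6 * (x % 7) % 7 + 7 * (x / 7) else x

/-- The map `x ↦ u * θ x * v`, where `θ` is given by `reflN t`. -/
def affineN (s t : Bool) (u v x : ℕ) : ℕ := mulN s (mulN s u (reflN t x)) v

/-- The blocks of a family pulled back along an affine map. -/
def pullback (s t : Bool) (u v : ℕ) (f : ℕ → ℕ → Bool) : List ℕ :=
  (List.range 21).map fun i => listMask ((List.range 21).filter fun x => f i (affineN s t u v x))

def pullbacks (s : Bool) (f : ℕ → ℕ → Bool) (us vs : List ℕ) : List (List ℕ) :=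
  [false, true].flatMap fun t => us.flatMap fun u => vs.map fun v => pullback s t u v f

def images : Bool → List (List ℕ)
  | false => pullbacks false (leftFamily false) [0] [0]
  | true => pullbacks true (leftFamily true) [0] (List.range 7) ++
      (pullbacks true (rightFamily true) (List.range 7) [0] ++
        pullbacks true mixedFamily [0] (List.range 21))

def families : Bool → List (ℕ → ℕ → Bool)
  | false => [leftFamily false]
  | true => [leftFamily true, rightFamily true, mixedFamily]

theorem exists_of_mem_pullbacks {s : Bool} {f : ℕ → ℕ → Bool} {us vs im : List ℕ}
    (hu : ∀ u ∈ us, u < 21) (hv : ∀ v ∈ vs, v < 21) (h : im ∈ pullbacks s f us vs) :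
    ∃ t, ∃ u < 21, ∃ v < 21, im = pullback s t u v f := by
  simp only [pullbacks, List.mem_flatMap, List.mem_map] at h
  obtain ⟨t, -, u, hu', v, hv', rfl⟩ := h
  exact ⟨t, u, hu u hu', v, hv v hv', rfl⟩

theorem exists_of_mem_images {s : Bool} {im : List ℕ} (h : im ∈ images s) :
    ∃ f ∈ families s, ∃ t, ∃ u < 21, ∃ v < 21, im = pullback s t u v f := by
  cases s with
  | false => exact ⟨_, by simp [families], exists_of_mem_pullbacks (by simp) (by simp) h⟩
  | true =>
    have h7 : ∀ u ∈ List.range 7, u < 21 := fun u hu => by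
      have := List.mem_range.1 hu
      omega
    rcases List.mem_append.1 h with h | h
    · exact ⟨_, by simp [families], exists_of_mem_pullbacks (by simp) h7 h⟩
    rcases List.mem_append.1 h with h | h
    · exact ⟨_, by simp [families], exists_of_mem_pullbacks h7 (by simp) h⟩
    · exact ⟨_, by simp [families], exists_of_mem_pullbacks (by simp) (by simp) h⟩

/-- Some member of `L` contains `l`. -/
def isCovered (L : List (List ℕ)) (l : List ℕ) : Bool :=
  L.any fun im => l.all fun x => im.any fun y => x.beq y

/-- The masks of the pairs `{x, y}` with `x < 3` and `x < y`. -/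
def pairs : List ℕ :=
  (List.range 3).flatMap fun x =>
    ((List.range 21).filter fun y => x.blt y).map fun y => listMask [x, y]

def classify (s : Bool) : Bool :=
  forceLists (images s) fun L => forceList (sidon s 21 5 [] 0 []) fun l =>
    forceList pairs fun ps => search (isCovered L) ps l

theorem classify_eq_true : ∀ s, classify s = true := by
  decide +kernel

/-- The mask of a set of elements of a group of order `21`. -/
def setMask {s : Bool} (B : Finset (Order21 s)) : ℕ :=
  listMask ((List.range 21).filter fun x => decide (∃ y ∈ B, y.val = x))

theorem testBit_setMask {s : Bool} (B : Finset (Order21 s)) (x : Order21 s) :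
    (setMask B).testBit x.val = true ↔ x ∈ B := by
  rw [setMask, testBit_listMask, List.mem_filter]
  simp only [List.mem_range, decide_eq_true_iff]
  constructor
  · rintro ⟨-, y, hy, hyx⟩
    rwa [← Order21.ext hyx]
  · exact fun h => ⟨x.val_lt, x, h, rfl⟩

theorem exists_of_testBit_setMask {s : Bool} {B : Finset (Order21 s)} {x : ℕ}
    (h : (setMask B).testBit x = true) : ∃ y ∈ B, y.val = x := by
  rw [setMask, testBit_listMask, List.mem_filter] at h
  exact of_decide_eq_true h.2

theorem setMask_mem_sidon {s : Bool} {B : Finset (Order21 s)} (hB : B.card = 5)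
    (hq : ∀ x ∈ B, ∀ y ∈ B, ∀ z ∈ B, ∀ w ∈ B, x ≠ y → x⁻¹ * y = z⁻¹ * w → x = z ∧ y = w) :
    setMask B ∈ sidon s 21 5 [] 0 [] := by
  have h := mem_sidon (s := s) (p := fun x => decide (∃ y ∈ B, y.val = x)) ?_ 21 5 [] 0 []
    (by simp) (by simp) ?_
  · rwa [List.append_nil] at h
  · intro x y z w hx hy hz hw hxy h
    obtain ⟨x, hx', rfl⟩ := of_decide_eq_true hx
    obtain ⟨y, hy', rfl⟩ := of_decide_eq_true hy
    obtain ⟨z, hz', rfl⟩ := of_decide_eq_true hz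
    obtain ⟨w, hw', rfl⟩ := of_decide_eq_true hw
    have := hq x hx' y hy' z hz' w hw' (fun h => hxy (congrArg _ h)) (Order21.ext h)
    exact ⟨congrArg _ this.1, congrArg _ this.2⟩
  · rw [← hB, ← List.toFinset_card_of_nodup (List.nodup_range.filter _)]
    symm
    refine Finset.card_bij (fun x _ => x.val) ?_ ?_ ?_
    · intro x hx
      simpa using ⟨x.val_lt, x, hx, rfl⟩
    · exact fun x _ y _ h => Order21.ext h
    · intro x hx
      obtain ⟨-, y, hy, rfl⟩ := by simpa using hx
      exact ⟨y, hy, rfl⟩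

/-- A projective plane whose blocks are difference sets is a pullback of a known one. -/
theorem exists_family {s : Bool} {B : Fin 21 → Finset (Order21 s)} (hB : ∀ i, (B i).card = 5)
    (hq : ∀ i, ∀ x ∈ B i, ∀ y ∈ B i, ∀ z ∈ B i, ∀ w ∈ B i,
      x ≠ y → x⁻¹ * y = z⁻¹ * w → x = z ∧ y = w)
    (hpair : ∀ x y, x ≠ y → ∃! i, x ∈ B i ∧ y ∈ B i) :
    ∃ f ∈ families s, ∃ (β : Equiv.Perm (Fin 21)) (t : Bool) (u v : Order21 s),
      ∀ i (x : Order21 s), x ∈ B i ↔ f (β i).val (affineN s t u.val v.val x.val) = true := by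
  let m : Fin 21 → ℕ := fun i => setMask (B i)
  have hm : Function.Injective m := by
    intro i j hij
    obtain ⟨x, hx, y, hy, hxy⟩ := Finset.one_lt_card.1 (by rw [hB i]; norm_num : 1 < (B i).card)
    have hmem : ∀ x, x ∈ B i → x ∈ B j := fun x hx => by
      have h : (m i).testBit x.val = true := (testBit_setMask _ x).2 hx
      rw [hij] at h
      exact (testBit_setMask _ x).1 h
    exact (hpair x y hxy).unique ⟨hx, hy⟩ ⟨hmem x hx, hmem y hy⟩
  have hF : ∀ x y, x ∈ Set.range m → y ∈ Set.range m → compatible x y = true := by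
    rintro _ _ ⟨i, rfl⟩ ⟨j, rfl⟩
    refine compatible_of_forall fun hij x y hxi hx' hyi hy' => ?_
    obtain ⟨x, hx, rfl⟩ := exists_of_testBit_setMask hxi
    obtain ⟨y, hy, rfl⟩ := exists_of_testBit_setMask hyi
    rw [testBit_setMask] at hx' hy'
    by_contra hxy
    refine hij (congrArg m ((hpair x y fun h => hxy (congrArg _ h)).unique ⟨hx, hy⟩ ⟨hx', hy'⟩))
  have hps : ∀ p ∈ pairs, ∃ x, x ∈ Set.range m ∧ x &&& p = p := by
    intro p hp
    simp only [pairs, List.mem_flatMap, List.mem_map, List.mem_filter, List.mem_range,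
      Nat.blt_eq] at hp
    obtain ⟨x, hx, y, ⟨hy, hxy⟩, rfl⟩ := hp
    have hx' : x < 21 := by omega
    obtain ⟨i, ⟨hi, hi'⟩, -⟩ := hpair (Order21.mk x hx') (Order21.mk y hy)
      fun h => hxy.ne (congrArg Order21.val h)
    rw [← testBit_setMask (B i)] at hi hi'
    refine ⟨m i, ⟨i, rfl⟩, Nat.eq_of_testBit_eq fun k => ?_⟩
    rw [Nat.testBit_and, Bool.and_eq_right_iff_imp, testBit_listMask]
    intro hk
    rcases List.mem_cons.1 hk with rfl | hk
    · exact hi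
    · rw [List.mem_singleton.1 hk]
      exact hi'
  have hl : ∀ x, x ∈ Set.range m → x ∈ sidon s 21 5 [] 0 [] := by
    rintro _ ⟨i, rfl⟩
    exact setMask_mem_sidon (hB i) (hq i)
  have hc := classify_eq_true s
  rw [classify, forceLists_eq, forceList_eq, forceList_eq] at hc
  obtain ⟨l, hl, hml⟩ := exists_leaf_of_search hF _ _ hps hl hc
  obtain ⟨im, him, hl⟩ := List.any_eq_true.1 hl
  obtain ⟨f, hf, t, u, hu, v, hv, rfl⟩ := exists_of_mem_images him
  have hβ : ∀ i : Fin 21, ∃ j : Fin 21, m i =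
      listMask ((List.range 21).filter fun x => f j (affineN s t u v x)) := by
    intro i
    obtain ⟨y, hy, hiy⟩ := List.any_eq_true.1 (List.all_eq_true.1 hl _ (hml _ ⟨i, rfl⟩))
    obtain ⟨j, hj, rfl⟩ := List.mem_map.1 hy
    exact ⟨⟨j, List.mem_range.1 hj⟩, Nat.eq_of_beq_eq_true hiy⟩
  choose β hβ using hβ
  have hinj : Function.Injective β := fun i j h => hm (by rw [hβ, hβ, h])
  refine ⟨f, hf, Equiv.ofBijective β (Finite.injective_iff_bijective.1 hinj), t,
    Order21.mk u hu, Order21.mk v hv, fun i x => ?_⟩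
  have h : (m i).testBit x.val = true ↔ x ∈ B i := testBit_setMask _ x
  rw [← h, hβ, testBit_listMask, List.mem_filter, List.mem_range]
  exact and_iff_right x.val_lt

end Families

section Paratopy

variable {v n : ℕ} {C₁ C₂ C₃ : (Fin n → Fin v) → ℤ}

theorem paratopic_refl (C : (Fin n → Fin v) → ℤ) : Paratopic v n C C :=
  ⟨1, 1, fun _ => rfl⟩

theorem paratopic_symm (h : Paratopic v n C₁ C₂) : Paratopic v n C₂ C₁ := by
  obtain ⟨γ, α, h⟩ := h
  refine ⟨γ⁻¹, fun t => (α (γ⁻¹ t))⁻¹, fun i => ?_⟩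
  rw [h]
  simp

theorem paratopic_trans (h : Paratopic v n C₁ C₂) (h' : Paratopic v n C₂ C₃) :
    Paratopic v n C₁ C₃ := by
  obtain ⟨γ, α, h⟩ := h
  obtain ⟨δ, β, h'⟩ := h'
  refine ⟨δ * γ, fun t => α t * β (γ t), fun i => ?_⟩
  rw [h', h]
  rfl

/-- The lines of `C` in direction `b` take at most `v` different values. -/
def FewLines (C : (Fin n → Fin v) → ℤ) (b : Fin n) : Prop :=
  ∃ ℓ : Fin v → Fin v → ℤ, ∀ i, ∃ j, ∀ t, C (Function.update i b t) = ℓ j t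

theorem exists_perm_fewLines (h : Paratopic v n C₁ C₂) :
    ∃ γ : Equiv.Perm (Fin n), ∀ b, FewLines C₁ b → FewLines C₂ (γ b) := by
  obtain ⟨γ, α, h⟩ := h
  refine ⟨γ, fun b ⟨ℓ, hℓ⟩ => ⟨fun j t => ℓ j (α b t), fun i => ?_⟩⟩
  obtain ⟨j, hj⟩ := hℓ fun t => α t (i (γ t))
  refine ⟨j, fun t => ?_⟩
  refine (h _).trans (Eq.trans ?_ (hj (α b t)))
  congr 1
  ext s
  rcases eq_or_ne s b with rfl | hs
  · simp
  · simp [hs]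

theorem not_fewLines {C : (Fin n → Fin v) → ℤ} {b : Fin n} (p : Fin (v + 1) → Fin n → Fin v)
    (hp : ∀ j k, j < k → ∃ t, C (Function.update (p j) b t) ≠ C (Function.update (p k) b t)) :
    ¬ FewLines C b := by
  rintro ⟨ℓ, hℓ⟩
  choose f hf using fun j => hℓ (p j)
  obtain ⟨j, k, hjk, h⟩ := Fintype.exists_ne_map_eq_of_card_lt f (by simp)
  have key : ∀ j k, j < k → f j ≠ f k := fun j k hjk h => by
    obtain ⟨t, ht⟩ := hp j k hjk
    exact ht (by rw [hf, hf, h])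
  rcases lt_or_gt_of_ne hjk with hjk | hjk
  · exact key _ _ hjk h
  · exact key _ _ hjk h.symm

end Paratopy

section Cubes

variable {v : ℕ} {G : Type} [Group G] [DecidableEq G]

/-- The cube `(x, y, z) ↦ [g y * g z ∈ B x]`. -/
def groupCube (g : Fin v ≃ G) (B : Fin v → Finset G) : (Fin 3 → Fin v) → ℤ :=
  fun i => if g (i 1) * g (i 2) ∈ B (i 0) then 1 else 0

/-- The cube `(x, y, z) ↦ [g x * g y * g z ∈ D]`. -/
def differenceCube (g : Fin v ≃ G) (D : Finset G) : (Fin 3 → Fin v) → ℤ :=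
  fun i => if g (i 0) * g (i 1) * g (i 2) ∈ D then 1 else 0

theorem paratopic_groupCube {H : Type} [Group H] [DecidableEq H] {g : Fin v ≃ G} {h : Fin v ≃ H}
    {B : Fin v → Finset G} {B' : Fin v → Finset H} (β : Equiv.Perm (Fin v)) (σ τ : H ≃ G)
    (hB : ∀ i x y, x * y ∈ B' i ↔ σ x * τ y ∈ B (β i)) :
    Paratopic v 3 (groupCube g B) (groupCube h B') := by
  refine ⟨1, ![β, (h.trans σ).trans g.symm, (h.trans τ).trans g.symm], fun i => ?_⟩
  simp [groupCube, hB]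

theorem fewLines_differenceCube_zero (g : Fin v ≃ G) (D : Finset G) :
    FewLines (differenceCube g D) 0 :=
  ⟨fun j t => if g t * g j ∈ D then 1 else 0,
    fun i => ⟨g.symm (g (i 1) * g (i 2)), fun t => by simp [differenceCube, mul_assoc]⟩⟩

theorem fewLines_differenceCube_two (g : Fin v ≃ G) (D : Finset G) :
    FewLines (differenceCube g D) 2 :=
  ⟨fun j t => if g j * g t ∈ D then 1 else 0,
    fun i => ⟨g.symm (g (i 0) * g (i 1)), fun t => by simp [differenceCube]⟩⟩

theorem fewLines_differenceCube_one (g : Fin v ≃ G) (D : Finset G)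
    (hG : ∀ x y : G, x * y = y * x) : FewLines (differenceCube g D) 1 :=
  ⟨fun j t => if g t * g j ∈ D then 1 else 0,
    fun i => ⟨g.symm (g (i 0) * g (i 2)), fun t => by
      simp [differenceCube, hG (g (i 0)), mul_assoc]⟩⟩

/-- The blocks `B i` form a symmetric design, and are difference sets. -/
structure IsDifferenceDesign (k l : ℕ) (B : Fin v → Finset G) [Fintype G] : Prop where
  card_inter : ∀ i j, (B i ∩ B j).card = if i = j then k else l
  card_blocks : ∀ x y, (Finset.univ.filter fun i => x ∈ B i ∧ y ∈ B i).card = if x = y then k else l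
  card_left : ∀ i h, ((B i).filter fun x => h * x ∈ B i).card = if h = 1 then k else l
  card_right : ∀ i h, ((B i).filter fun x => x * h ∈ B i).card = if h = 1 then k else l

namespace IsDifferenceDesign

variable [Fintype G] {k l : ℕ} {B : Fin v → Finset G}

theorem card_eq (hB : IsDifferenceDesign k l B) (i : Fin v) : (B i).card = k := by
  simpa using hB.card_inter i i

theorem card_quotients (hB : IsDifferenceDesign k l B) (i : Fin v) {h : G} (hh : h ≠ 1) :
    ((B i ×ˢ B i).filter fun p => p.1⁻¹ * p.2 = h).card = l := by
  rw [← (hB.card_right i h).trans (if_neg hh)]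
  refine Finset.card_nbij' (fun p => p.1) (fun x => (x, x * h)) ?_ ?_ ?_ ?_
  · rintro ⟨x, y⟩ hp
    simp only [Finset.coe_filter, Finset.mem_product, Set.mem_ofPred_eq] at hp ⊢
    obtain ⟨⟨hx, hy⟩, rfl⟩ := hp
    simpa [hx] using hy
  · intro x hx
    simpa using hx
  · rintro ⟨x, y⟩ hp
    simp only [Finset.coe_filter, Finset.mem_product, Set.mem_ofPred_eq] at hp ⊢
    simp [← hp.2]
  · intro x _
    rfl

theorem isCubeOfDesigns (hB : IsDifferenceDesign k l B) (g : Fin v ≃ G) :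
    IsCubeOfDesigns v k l 3 (groupCube g B) := by
  refine ⟨fun i => ?_, fun x y hxy fixed => ?_⟩
  · unfold groupCube
    split_ifs <;> simp
  have hsum : ∀ (P Q : Fin v → Prop) [DecidablePred P] [DecidablePred Q],
      ∑ c, (if P c then (1 : ℤ) else 0) * (if Q c then 1 else 0) =
        ((Finset.univ.filter fun c => P c ∧ Q c).card : ℤ) := fun P Q _ _ => by
    simp [← ite_and, Finset.sum_boole, and_comm]
  have hcard : ∀ (σ : Fin v ≃ G) (S : Finset G) (P : G → Prop) [DecidablePred P],
      (Finset.univ.filter fun c => σ c ∈ S ∧ P (σ c)).card = (S.filter P).card := fun σ S P _ =>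
    Finset.card_equiv σ (by simp)
  ext a b
  have hab : (((k : ℤ) - l) • (1 : Matrix (Fin v) (Fin v) ℤ) +
      (l : ℤ) • Matrix.of (fun _ _ => (1 : ℤ)) : Matrix (Fin v) (Fin v) ℤ) a b =
        ((if a = b then k else l : ℕ) : ℤ) := by
    by_cases h : a = b <;>
      simp only [Matrix.add_apply, Matrix.smul_apply, Matrix.one_apply, Matrix.of_apply, h] <;> simp
  rw [hab, Matrix.mul_apply]
  simp only [Matrix.of_apply, Matrix.transpose_apply, groupCube]
  rw [hsum, Nat.cast_inj]
  have inter : ∀ σ : Fin v ≃ G,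
      (Finset.univ.filter fun c => σ c ∈ B a ∧ σ c ∈ B b).card = if a = b then k else l :=
    fun σ => by rw [hcard σ (B a), Finset.filter_mem_eq_inter, hB.card_inter]
  have left : ∀ i, (Finset.univ.filter fun c => g a * g c ∈ B i ∧ g b * g c ∈ B i).card =
      if a = b then k else l := fun i => by
    have := hB.card_left i (g b * (g a)⁻¹)
    simp only [mul_inv_eq_one, g.apply_eq_iff_eq, eq_comm (a := b)] at this
    rw [← this, ← hcard (g.trans (Equiv.mulLeft (g a)))]
    simp [mul_assoc]
  have right : ∀ i, (Finset.univ.filter fun c => g c * g a ∈ B i ∧ g c * g b ∈ B i).card =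
      if a = b then k else l := fun i => by
    have := hB.card_right i ((g a)⁻¹ * g b)
    simp only [inv_mul_eq_one, g.apply_eq_iff_eq] at this
    rw [← this, ← hcard (g.trans (Equiv.mulRight (g a)))]
    simp [mul_assoc]
  fin_cases x <;> fin_cases y <;> try exact absurd rfl hxy
  · exact inter (g.trans (Equiv.mulRight (g (fixed 2))))
  · exact inter (g.trans (Equiv.mulLeft (g (fixed 1))))
  · simpa using hB.card_blocks (g a * g (fixed 2)) (g b * g (fixed 2))
  · simpa using left (fixed 0)
  · simpa using hB.card_blocks (g (fixed 1) * g a) (g (fixed 1) * g b)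
  · simpa using right (fixed 0)

theorem isGroupCube (hB : IsDifferenceDesign k l B) (g : Fin v ≃ G) :
    IsGroupCube v k l (groupCube g B) :=
  ⟨G, _, _, _, by simpa using (Fintype.card_congr g).symm, g, B, hB.card_eq,
    fun i _ => hB.card_quotients i, fun x y hxy => (hB.card_blocks x y).trans (if_neg hxy),
    paratopic_refl _⟩

theorem isDifferenceCube (hB : IsDifferenceDesign k l B) (g : Fin v ≃ G) (i : Fin v) :
    IsDifferenceCube v k l (differenceCube g (B i)) :=
  ⟨G, _, _, _, by simpa using (Fintype.card_congr g).symm, g, B i, hB.card_eq i,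
    fun _ => hB.card_quotients i, paratopic_refl _⟩

end IsDifferenceDesign

end Cubes

section Representatives

/-- The index bijection. -/
def index (s : Bool) : Fin 21 ≃ Order21 s := Equiv.refl _

/-- The `i`-th block of a family, as a set of group elements. -/
def block (s : Bool) (f : ℕ → ℕ → Bool) (i : Fin 21) : Finset (Order21 s) :=
  Finset.univ.filter fun x => f i.val x.val

theorem mem_block {s : Bool} {f : ℕ → ℕ → Bool} {i : Fin 21} {x : Order21 s} :
    x ∈ block s f i ↔ f i.val x.val = true := by
  simp [block]

theorem isDifferenceDesign_left (s : Bool) :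
    IsDifferenceDesign 5 1 (block s (leftFamily s)) := by
  constructor <;> cases s <;> decide +kernel

theorem isDifferenceDesign_mixed : IsDifferenceDesign 5 1 (block true mixedFamily) := by
  constructor <;> decide +kernel

def leftCube (s : Bool) : (Fin 3 → Fin 21) → ℤ := groupCube (index s) (block s (leftFamily s))

def mixedCube : (Fin 3 → Fin 21) → ℤ := groupCube (index true) (block true mixedFamily)

theorem leftCube_eq (s : Bool) :
    leftCube s = differenceCube (index s) (block s (leftFamily s) 0) := by
  have key : ∀ x y : Order21 s, leftFamily s x.val y.val = leftFamily s 0 (x * y).val := by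
    cases s <;> decide +kernel
  ext i
  simp only [leftCube, groupCube, differenceCube, mem_block, mul_assoc]
  rw [show (i 0).val = (index s (i 0)).val from rfl, key]
  rfl

theorem not_fewLines_leftCube : ¬ FewLines (leftCube true) 1 :=
  not_fewLines (fun n => ![⟨n.val / 21, by omega⟩, 0, ⟨n.val % 21, by omega⟩]) (by decide +kernel)

theorem not_fewLines_mixedCube_one : ¬ FewLines mixedCube 1 :=
  not_fewLines (fun n => ![⟨n.val / 21, by omega⟩, 0, ⟨n.val % 21, by omega⟩]) (by decide +kernel)

theorem not_fewLines_mixedCube_two : ¬ FewLines mixedCube 2 :=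
  not_fewLines (fun n => ![⟨n.val / 21, by omega⟩, ⟨n.val % 21, by omega⟩, 0]) (by decide +kernel)

theorem fewLines_leftCube (b : Fin 3) (hb : b ≠ 1) (s : Bool) : FewLines (leftCube s) b := by
  rw [leftCube_eq]
  fin_cases b
  · exact fewLines_differenceCube_zero _ _
  · exact absurd rfl hb
  · exact fewLines_differenceCube_two _ _

theorem fewLines_leftCube_false (b : Fin 3) : FewLines (leftCube false) b := by
  by_cases hb : b = 1
  · rw [leftCube_eq, hb]
    exact fewLines_differenceCube_one _ _ (by decide +kernel)
  · exact fewLines_leftCube b hb false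

theorem not_paratopic_of_fewLines {C C' : (Fin 3 → Fin 21) → ℤ} (hC : ∀ b, FewLines C b)
    {b : Fin 3} (hb : ¬ FewLines C' b) : ¬ Paratopic 21 3 C C' := fun h => by
  obtain ⟨γ, hγ⟩ := exists_perm_fewLines h
  exact hb (by simpa using hγ (γ.symm b) (hC _))

theorem not_paratopic_mixedCube {C : (Fin 3 → Fin 21) → ℤ} (h0 : FewLines C 0)
    (h2 : FewLines C 2) : ¬ Paratopic 21 3 C mixedCube := fun h => by
  obtain ⟨γ, hγ⟩ := exists_perm_fewLines h
  have key : ∀ b, FewLines mixedCube b → b = 0 := fun b hb => by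
    fin_cases b
    · rfl
    · exact absurd hb not_fewLines_mixedCube_one
    · exact absurd hb not_fewLines_mixedCube_two
  exact absurd (γ.injective ((key _ (hγ 0 h0)).trans (key _ (hγ 2 h2)).symm)) (by decide)

theorem not_isDifferenceCube_mixedCube : ¬ IsDifferenceCube 21 5 1 mixedCube := by
  rintro ⟨G, _, _, _, -, g, D, -, -, h⟩
  exact not_paratopic_mixedCube (fewLines_differenceCube_zero g D)
    (fewLines_differenceCube_two g D) (paratopic_symm h)

/-- The automorphism inverting `a` and fixing `b`, if `t` is true. -/
def refl (s t : Bool) : Order21 s ≃* Order21 s where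
  toFun x := Order21.mk (reflN t x.val % 21) (Nat.mod_lt _ (by norm_num))
  invFun x := Order21.mk (reflN t x.val % 21) (Nat.mod_lt _ (by norm_num))
  left_inv := by cases s <;> cases t <;> decide +kernel
  right_inv := by cases s <;> cases t <;> decide +kernel
  map_mul' := by cases s <;> cases t <;> decide +kernel

theorem affineN_val {s : Bool} (t : Bool) (u v x : Order21 s) :
    affineN s t u.val v.val x.val = (u * refl s t x * v).val := by
  have : reflN t x.val % 21 = reflN t x.val := Nat.mod_eq_of_lt (by
    have := x.val_lt
    cases t
    · exact this
    · simp only [reflN, cond_true]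
      omega)
  simp [affineN, refl, Order21.val_mul, this]

theorem paratopic_rightCube :
    Paratopic 21 3 (groupCube (index true) (block true (rightFamily true))) (leftCube true) := by
  have key : ∀ x y : Order21 true,
      rightFamily true x.val y.val = leftFamily true 0 (y * x).val := by
    decide +kernel
  refine paratopic_symm ⟨finRotate 3, 1, fun i => ?_⟩
  rw [leftCube_eq]
  simp only [groupCube, differenceCube, mem_block]
  rw [show (i 0).val = (index true (i 0)).val from rfl, key]
  rfl

theorem isGroupCube_classification {C : (Fin 3 → Fin 21) → ℤ} (hC : IsGroupCube 21 5 1 C) :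
    Paratopic 21 3 C (leftCube false) ∨ Paratopic 21 3 C (leftCube true) ∨
      Paratopic 21 3 C mixedCube := by
  obtain ⟨G, _, _, _, hG, g, B, hcard, hquot, hpair, hC⟩ := hC
  obtain ⟨s, ⟨e⟩⟩ := exists_mulEquiv_order21 hG
  let B' : Fin 21 → Finset (Order21 s) := fun i => (B i).map e.symm.toEquiv.toEmbedding
  have hB' : ∀ i x, x ∈ B' i ↔ e x ∈ B i := fun i x => Finset.mem_map_equiv
  have hq : ∀ i, ∀ x ∈ B' i, ∀ y ∈ B' i, ∀ z ∈ B' i, ∀ w ∈ B' i,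
      x ≠ y → x⁻¹ * y = z⁻¹ * w → x = z ∧ y = w := by
    intro i x hx y hy z hz w hw hxy h
    rw [hB'] at hx hy hz hw
    obtain ⟨p, hp⟩ := Finset.card_eq_one.1 (hquot i (e (x⁻¹ * y))
      (by simpa [inv_mul_eq_one] using hxy))
    have h1 : (e x, e y) = p := Finset.mem_singleton.1 (hp ▸ by simp [hx, hy])
    have h2 : (e z, e w) = p := Finset.mem_singleton.1 (hp ▸ by simp [hz, hw, h])
    simpa using h1.trans h2.symm
  have hp : ∀ x y, x ≠ y → ∃! i, x ∈ B' i ∧ y ∈ B' i := by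
    intro x y hxy
    obtain ⟨i, hi⟩ := Finset.card_eq_one.1 (hpair (e x) (e y) (e.injective.ne hxy))
    have key : ∀ j, (x ∈ B' j ∧ y ∈ B' j) ↔ j = i := fun j => by
      rw [← Finset.mem_singleton, ← hi]
      simp [hB']
    exact ⟨i, (key i).2 rfl, fun j hj => (key j).1 hj⟩
  obtain ⟨f, hf, β, t, u, v, h⟩ := exists_family (by simpa [B'] using hcard) hq hp
  have h1 : Paratopic 21 3 (groupCube g B) (groupCube (index s) B') :=
    paratopic_groupCube 1 e.toEquiv e.toEquiv (by simp [hB'])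
  have h2 : Paratopic 21 3 (groupCube (index s) (block s f)) (groupCube (index s) B') :=
    paratopic_groupCube β ((refl s t).toEquiv.trans (Equiv.mulLeft u))
      ((refl s t).toEquiv.trans (Equiv.mulRight v)) fun i x y => by
        rw [h, affineN_val, ← mem_block]
        simp [mul_assoc]
  have h3 := paratopic_trans hC (paratopic_trans h1 (paratopic_symm h2))
  cases s with
  | false =>
    obtain rfl := List.mem_singleton.1 hf
    exact .inl h3
  | true =>
    rcases List.mem_cons.1 hf with rfl | hf
    · exact .inr (.inl h3)
    rcases List.mem_cons.1 hf with rfl | hf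
    · exact .inr (.inl (paratopic_trans h3 paratopic_rightCube))
    · obtain rfl := List.mem_singleton.1 hf
      exact .inr (.inr h3)

end Representatives

end GroupCubes

/-- Proposition 5.3 of the paper. The group cubes among the `3`-dimensional
cubes of symmetric `(21,5,1)` designs fall into exactly three paratopy classes, exactly two of
which contain a difference cube. -/
theorem group_cubes_21_5_1_classification :
    ∃ C₁ C₂ C₃ : (Fin 3 → Fin 21) → ℤ,
      (IsCubeOfDesigns 21 5 1 3 C₁ ∧ IsGroupCube 21 5 1 C₁) ∧
      (IsCubeOfDesigns 21 5 1 3 C₂ ∧ IsGroupCube 21 5 1 C₂) ∧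
      (IsCubeOfDesigns 21 5 1 3 C₃ ∧ IsGroupCube 21 5 1 C₃) ∧
      ¬ Paratopic 21 3 C₁ C₂ ∧ ¬ Paratopic 21 3 C₁ C₃ ∧ ¬ Paratopic 21 3 C₂ C₃ ∧
      (∀ C : (Fin 3 → Fin 21) → ℤ, IsCubeOfDesigns 21 5 1 3 C → IsGroupCube 21 5 1 C →
        Paratopic 21 3 C C₁ ∨ Paratopic 21 3 C C₂ ∨ Paratopic 21 3 C C₃) ∧
      IsDifferenceCube 21 5 1 C₁ ∧ IsDifferenceCube 21 5 1 C₂ ∧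
      ¬ IsDifferenceCube 21 5 1 C₃ := by
  refine ⟨GroupCubes.leftCube false, GroupCubes.leftCube true, GroupCubes.mixedCube,
    ⟨(GroupCubes.isDifferenceDesign_left _).isCubeOfDesigns _,
      (GroupCubes.isDifferenceDesign_left _).isGroupCube _⟩,
    ⟨(GroupCubes.isDifferenceDesign_left _).isCubeOfDesigns _,
      (GroupCubes.isDifferenceDesign_left _).isGroupCube _⟩,
    ⟨GroupCubes.isDifferenceDesign_mixed.isCubeOfDesigns _,
      GroupCubes.isDifferenceDesign_mixed.isGroupCube _⟩,
    GroupCubes.not_paratopic_of_fewLines GroupCubes.fewLines_leftCube_false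
      GroupCubes.not_fewLines_leftCube,
    GroupCubes.not_paratopic_of_fewLines GroupCubes.fewLines_leftCube_false
      GroupCubes.not_fewLines_mixedCube_one,
    GroupCubes.not_paratopic_mixedCube (GroupCubes.fewLines_leftCube 0 (by decide) true)
      (GroupCubes.fewLines_leftCube 2 (by decide) true),
    fun C _ hC => GroupCubes.isGroupCube_classification hC, ?_, ?_,
    GroupCubes.not_isDifferenceCube_mixedCube⟩
  all_goals
    rw [GroupCubes.leftCube_eq]
    exact (GroupCubes.isDifferenceDesign_left _).isDifferenceCube _ 0
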